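/- Let k ≥ 2 be an integer, let c_k ≥ ((k−1)/k)·2γ be a real number, and set p = √(c_k·n/k). If G is a finite simple graph of order n with minimum degree δ(G) ≥ k·p = √(c_k·k·n), then G has a k-proper partition 𝒫 with |𝒫| ≤ (k/(k−1))·p. -/

import Mathlib

open SimpleGraph

/-- A graph is `k`-connected if the removal of any set of fewer than `k` vertices
results in a connected graph with at least two vertices. -/
def KConnected {V : Type*} (k : ℕ) (G : SimpleGraph V) : Prop :=
  ∀ S : Set V, S.ncard < k → (G.induce Sᶜ).Connected ∧ 2 ≤ Sᶜ.ncard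

/-- A partition of the vertex set of `G` is `k`-proper if every part induces a
`k`-connected subgraph. -/
def KProperPartition {V : Type*} [Fintype V] [DecidableEq V] (k : ℕ) (G : SimpleGraph V)
    (P : Finpartition (Finset.univ : Finset V)) : Prop :=
  ∀ p ∈ P.parts, KConnected k (G.induce (p : Set V))

/-- `G` contains a `k`-connected subgraph. -/
def HasKConnSubgraph {V : Type*} (k : ℕ) (G : SimpleGraph V) : Prop :=
  ∃ H : G.Subgraph, KConnected k H.coe

/-- `e(k,n)`: the maximum number of edges of a simple graph of order `n`
containing no `k`-connected subgraph. -/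
noncomputable def maxEdgesNoKConn (k n : ℕ) : ℕ :=
  sSup {m : ℕ | ∃ G : SimpleGraph (Fin n), ¬ HasKConnSubgraph k G ∧ G.edgeSet.ncard = m}

/-- `d(k) = sup { (2 e(k,n) + 2)/n : n > k }`. -/
noncomputable def dConst (k : ℕ) : ℝ :=
  sSup {x : ℝ | ∃ n : ℕ, k < n ∧ x = (2 * (maxEdgesNoKConn k n : ℝ) + 2) / (n : ℝ)}

/-- `γ = sup { d(k)/(k-1) : k ≥ 2 }`. -/
noncomputable def gammaConst : ℝ :=
  sSup {x : ℝ | ∃ k : ℕ, 2 ≤ k ∧ x = dConst k / ((k : ℝ) - 1)}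

/-- Finset formulation of `k`-connectedness of the subgraph of `G` induced by `W`: deleting fewer
than `k` vertices leaves at least two vertices and no proper union of components. -/
def IsKConn {V : Type*} [DecidableEq V] (G : SimpleGraph V) (k : ℕ) (W : Finset V) : Prop :=
  ∀ S ⊆ W, S.card < k → 2 ≤ (W \ S).card ∧
    ∀ A ⊆ W \ S, A.Nonempty → (∀ a ∈ A, ∀ b ∈ W \ S, G.Adj a b → b ∈ A) → A = W \ S

section Connectivity

variable {V : Type*}

lemma mem_of_reachable_of_closed {G : SimpleGraph V} {A : Set V}
    (hA : ∀ a ∈ A, ∀ b, G.Adj a b → b ∈ A) {u v : V} (h : G.Reachable u v) (hu : u ∈ A) :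
    v ∈ A := by
  obtain ⟨w⟩ := h
  induction w with
  | nil => exact hu
  | cons hab _ ih => exact ih (hA _ hu _ hab)

lemma IsKConn.kConnected_induce [DecidableEq V] {G : SimpleGraph V} {k : ℕ} {W : Finset V}
    (h : IsKConn G k W) : KConnected k (G.induce (W : Set V)) := by
  classical
  intro S hS
  set T : Finset V := W.filter (fun v => ∃ hv : v ∈ W, (⟨v, hv⟩ : (W : Set V)) ∈ S) with hT
  have hTS : (T : Set V) = Subtype.val '' S := by
    ext v
    simp [hT]
  have hTc : T.card < k := by
    rw [← Set.ncard_coe_finset, hTS, Set.ncard_image_of_injective _ Subtype.val_injective]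
    exact hS
  have hWT : ((W \ T : Finset V) : Set V) = Subtype.val '' Sᶜ := by
    ext v
    simp only [hT, Finset.coe_sdiff, Finset.coe_filter, Set.mem_sdiff, Finset.mem_coe,
      Set.mem_ofPred_eq, Set.mem_image, Set.mem_compl_iff, Subtype.exists]
    grind
  obtain ⟨h2, hcut⟩ := h T (Finset.filter_subset _ _) hTc
  have h2' : 2 ≤ Sᶜ.ncard := by
    rw [← Set.ncard_image_of_injective Sᶜ Subtype.val_injective, ← hWT, Set.ncard_coe_finset]
    exact h2
  refine ⟨?_, h2'⟩
  have hne : Nonempty (Sᶜ : Set (W : Set V)) := by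
    rw [Set.nonempty_coe_sort]
    exact Set.nonempty_of_ncard_ne_zero (by omega)
  refine (SimpleGraph.connected_iff _).2 ⟨fun u v => ?_, hne⟩
  set H := (G.induce (W : Set V)).induce Sᶜ
  set A : Finset V := (W \ T).filter (fun x => ∃ y, H.Reachable u y ∧ y.1.1 = x) with hA
  have hmem : ∀ y : (Sᶜ : Set (W : Set V)), y.1.1 ∈ W \ T := by
    intro y
    rw [← Finset.mem_coe, hWT]
    exact ⟨y.1, y.2, rfl⟩
  have hAeq := hcut A (Finset.filter_subset _ _)
    ⟨u.1.1, Finset.mem_filter.2 ⟨hmem u, u, SimpleGraph.Reachable.refl _, rfl⟩⟩ (by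
      intro a ha b hb hab
      obtain ⟨_, y, hy, rfl⟩ := Finset.mem_filter.1 ha
      have hb' := hb
      rw [← Finset.mem_coe, hWT] at hb'
      obtain ⟨z, hz, rfl⟩ := hb'
      refine Finset.mem_filter.2 ⟨hb, ⟨z, hz⟩, hy.trans (SimpleGraph.Adj.reachable ?_), rfl⟩
      exact hab)
  have hv := hmem v
  rw [← hAeq] at hv
  obtain ⟨_, y, hy, hyv⟩ := Finset.mem_filter.1 hv
  rwa [Subtype.ext (Subtype.ext hyv)] at hy

lemma KConnected.isKConn_map {X : Type*} [Fintype X] [DecidableEq V] {H : SimpleGraph X}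
    {G : SimpleGraph V} {k : ℕ} (h : KConnected k H) (f : X ↪ V)
    (hf : ∀ x y, H.Adj x y → G.Adj (f x) (f y)) : IsKConn G k (Finset.univ.map f) := by
  classical
  intro S hSW hS
  have himg : f '' (f ⁻¹' (S : Set V)) = S := by
    refine Set.image_preimage_eq_of_subset fun x hx => ?_
    simpa using hSW hx
  have himgc : f '' (f ⁻¹' (S : Set V))ᶜ = (Finset.univ.map f \ S : Finset V) := by
    ext v
    simp only [Set.mem_image, Set.mem_compl_iff, Set.mem_preimage, Finset.mem_coe,
      Finset.mem_sdiff, Finset.mem_map, Finset.mem_univ, true_and]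
    grind
  obtain ⟨hconn, h2⟩ := h (f ⁻¹' (S : Set V)) (by
    rw [← Set.ncard_image_of_injective _ f.injective, himg, Set.ncard_coe_finset]
    exact hS)
  refine ⟨?_, fun A hA hne hcl => Finset.Subset.antisymm hA fun v hv => ?_⟩
  · rwa [← Set.ncard_image_of_injective _ f.injective, himgc, Set.ncard_coe_finset] at h2
  · obtain ⟨a, ha⟩ := hne
    have ha' := hA ha
    rw [← Finset.mem_coe, ← himgc] at ha' hv
    obtain ⟨x, hx, rfl⟩ := ha'
    obtain ⟨y, hy, rfl⟩ := hv
    refine mem_of_reachable_of_closed (A := {z : ((f ⁻¹' (S : Set V))ᶜ : Set X) | f z.1 ∈ A}) ?_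
      (hconn.preconnected ⟨x, hx⟩ ⟨y, hy⟩) (show f x ∈ A from ha)
    intro z hz w hzw
    refine hcl _ hz _ ?_ (hf _ _ hzw)
    rw [← Finset.mem_coe, ← himgc]
    exact ⟨w.1, w.2, rfl⟩

variable [DecidableEq V] {G : SimpleGraph V} {k : ℕ} {W : Finset V}

lemma IsKConn.mono {l : ℕ} (h : IsKConn G k W) (hl : l ≤ k) : IsKConn G l W :=
  fun S hS hc => h S hS (hc.trans_le hl)

lemma IsKConn.lt_card (h : IsKConn G k W) (hk : 1 ≤ k) : k < W.card := by
  by_cases hc : W.card < k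
  · have := (h W subset_rfl hc).1
    simp at this
  · obtain ⟨S, hS, hSc⟩ := Finset.exists_subset_card_eq (s := W) (n := k - 1) (by omega)
    have := (h S hS (by omega)).1
    rw [Finset.card_sdiff_of_subset hS] at this
    omega

lemma IsKConn.insert_vertex [DecidableRel G.Adj] (h : IsKConn G k W) {v : V} (hv : v ∉ W)
    (hdeg : k ≤ (W.filter (G.Adj v)).card) : IsKConn G k (insert v W) := by
  intro S hS hc
  by_cases hvS : v ∈ S
  · have heq : insert v W \ S = W \ S.erase v := by
      ext x
      simp only [Finset.mem_sdiff, Finset.mem_insert, Finset.mem_erase]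
      grind
    rw [heq]
    refine h _ (fun x hx => ?_) ((Finset.card_erase_le).trans_lt hc)
    have := hS (Finset.mem_of_mem_erase hx)
    exact (Finset.mem_insert.1 this).resolve_left (Finset.ne_of_mem_erase hx)
  · have hSW : S ⊆ W := fun x hx =>
      (Finset.mem_insert.1 (hS hx)).resolve_left (fun e => hvS (e ▸ hx))
    have heq : insert v W \ S = insert v (W \ S) := Finset.insert_sdiff_of_notMem _ hvS
    obtain ⟨h2, hcut⟩ := h S hSW hc
    rw [heq]
    refine ⟨h2.trans (Finset.card_le_card (Finset.subset_insert _ _)), fun A hA hne hcl => ?_⟩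
    obtain ⟨w, hw, hwS⟩ := Finset.exists_mem_notMem_of_card_lt_card (hc.trans_le hdeg)
    obtain ⟨hwW, hvw⟩ := Finset.mem_filter.1 hw
    have hwWS : w ∈ W \ S := Finset.mem_sdiff.2 ⟨hwW, hwS⟩
    have hne' : (A.erase v).Nonempty := by
      by_contra hemp
      obtain ⟨a, ha⟩ := hne
      have hav : a = v := by
        by_contra hav
        exact hemp ⟨a, Finset.mem_erase.2 ⟨hav, ha⟩⟩
      subst hav
      exact hemp ⟨w, Finset.mem_erase.2 ⟨hvw.ne', hcl _ ha _ (Finset.mem_insert_of_mem hwWS) hvw⟩⟩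
    have hAeq := hcut (A.erase v)
      (fun x hx => (Finset.mem_insert.1 (hA (Finset.mem_of_mem_erase hx))).resolve_left
        (Finset.ne_of_mem_erase hx)) hne' (by
        intro a ha b hb hab
        refine Finset.mem_erase.2 ⟨?_, hcl _ (Finset.mem_of_mem_erase ha) _
          (Finset.mem_insert_of_mem hb) hab⟩
        rintro rfl
        exact hv (Finset.mem_sdiff.1 hb).1)
    have hvA : v ∈ A := by
      rw [← hAeq] at hwWS
      exact hcl _ (Finset.mem_of_mem_erase hwWS) _ (Finset.mem_insert_self _ _) hvw.symm
    rw [← hAeq, Finset.insert_erase hvA]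

lemma hasKConnSubgraph_of_isKConn (h : IsKConn G k W) : HasKConnSubgraph k G := by
  refine ⟨(⊤ : G.Subgraph).induce (W : Set V), ?_⟩
  have := h.kConnected_induce
  rwa [SimpleGraph.induce_eq_coe_induce_top] at this

lemma HasKConnSubgraph.exists_isKConn {X : Type*} [Fintype X] {H : SimpleGraph X}
    (h : HasKConnSubgraph k H) (f : X ↪ V) (hf : ∀ x y, H.Adj x y → G.Adj (f x) (f y)) :
    ∃ W ⊆ Finset.univ.map f, IsKConn G k W := by
  classical
  obtain ⟨K, hK⟩ := h
  refine ⟨_, ?_, hK.isKConn_map ((Function.Embedding.subtype (· ∈ K.verts)).trans f) ?_⟩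
  · intro v hv
    obtain ⟨x, _, rfl⟩ := Finset.mem_map.1 hv
    simp
  · exact fun x y hxy => hf _ _ (K.adj_sub hxy)

end Connectivity

section Mader

lemma card_filter_adj_add_card_le {V : Type*} (G : SimpleGraph V) [DecidableRel G.Adj]
    (W : Finset V) :
    ((W ×ˢ W).filter (fun x => G.Adj x.1 x.2)).card + W.card ≤ W.card * W.card := by
  have hsub : (W ×ˢ W).filter (fun x => G.Adj x.1 x.2) ⊆ W.offDiag := by
    rintro ⟨a, b⟩ hab
    simp only [Finset.mem_filter, Finset.mem_product, Finset.mem_offDiag] at hab ⊢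
    exact ⟨hab.1.1, hab.1.2, hab.2.ne⟩
  have h1 := Finset.card_le_card hsub
  rw [Finset.offDiag_card] at h1
  have := Nat.le_mul_self W.card
  omega

variable {V : Type*} [DecidableEq V] (G : SimpleGraph V) [DecidableRel G.Adj]

lemma card_filter_adj_erase_add (W : Finset V) (v : V) :
    ((W ×ˢ W).filter (fun x => G.Adj x.1 x.2)).card ≤
      ((W.erase v ×ˢ W.erase v).filter (fun x => G.Adj x.1 x.2)).card
        + 2 * (W.filter (G.Adj v)).card := by
  have hsub : (W ×ˢ W).filter (fun x => G.Adj x.1 x.2) ⊆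
      (W.erase v ×ˢ W.erase v).filter (fun x => G.Adj x.1 x.2) ∪
        ((W.filter (G.Adj v)).image (fun w => (v, w)) ∪
          (W.filter (G.Adj v)).image (fun w => (w, v))) := by
    rintro ⟨a, b⟩ hab
    simp only [Finset.mem_filter, Finset.mem_product, Finset.mem_union, Finset.mem_image,
      Finset.mem_erase, Prod.mk.injEq] at hab ⊢
    by_cases ha : a = v
    · subst ha
      exact Or.inr (Or.inl ⟨b, ⟨hab.1.2, hab.2⟩, rfl, rfl⟩)
    · by_cases hb : b = v
      · subst hb
        exact Or.inr (Or.inr ⟨a, ⟨hab.1.1, hab.2.symm⟩, rfl, rfl⟩)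
      · exact Or.inl ⟨⟨⟨ha, hab.1.1⟩, hb, hab.1.2⟩, hab.2⟩
  have h1 := Finset.card_le_card hsub
  have h2 := Finset.card_union_le
    ((W.erase v ×ˢ W.erase v).filter (fun x => G.Adj x.1 x.2))
    ((W.filter (G.Adj v)).image (fun w => (v, w)) ∪ (W.filter (G.Adj v)).image (fun w => (w, v)))
  have h3 := Finset.card_union_le
    ((W.filter (G.Adj v)).image (fun w => (v, w))) ((W.filter (G.Adj v)).image (fun w => (w, v)))
  have h4 : ((W.filter (G.Adj v)).image (fun w => (v, w))).card ≤ _ := Finset.card_image_le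
  have h5 : ((W.filter (G.Adj v)).image (fun w => (w, v))).card ≤ _ := Finset.card_image_le
  omega

/-- Mader's theorem: a graph of order at least `2s` and average degree at least about `4s` contains
an `(s+1)`-connected induced subgraph. -/
theorem exists_isKConn_of_card_adj {s : ℕ} (hs : 1 ≤ s) (W : Finset V) (hW : 2 * s ≤ W.card)
    (hE : 4 * s * W.card < ((W ×ˢ W).filter (fun x => G.Adj x.1 x.2)).card + 4 * s * s) :
    ∃ U ⊆ W, IsKConn G (s + 1) U := by
  induction hn : W.card using Nat.strong_induction_on generalizing W with
  | _ n ih =>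
  subst hn
  by_contra hno
  have hmin : ∀ U ⊂ W, 2 * s ≤ U.card →
      ((U ×ˢ U).filter (fun x => G.Adj x.1 x.2)).card + 4 * s * s ≤ 4 * s * U.card := by
    intro U hU hUc
    by_contra! hlt
    obtain ⟨T, hT, hTc⟩ := ih _ (Finset.card_lt_card hU) U hUc hlt rfl
    exact hno ⟨T, hT.trans hU.1, hTc⟩
  have hcard : 2 * s < W.card := by
    refine lt_of_le_of_ne hW fun heq => ?_
    have := card_filter_adj_add_card_le G W
    rw [← heq] at this hE
    nlinarith
  have hdeg : ∀ v ∈ W, 2 * s < (W.filter (G.Adj v)).card := by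
    intro v hv
    by_contra! hle
    have h1 := card_filter_adj_erase_add G W v
    have h2 := Finset.card_erase_add_one hv
    have h3 := hmin _ (Finset.erase_ssubset hv) (by omega)
    rw [← h2] at hE
    nlinarith
  refine hno ⟨W, subset_rfl, fun S hS hSc => ?_⟩
  have hSW := Finset.card_sdiff_add_card_eq_card hS
  refine ⟨by omega, fun A hA hne hcl => ?_⟩
  by_contra hAW
  obtain ⟨u, hu⟩ := hne
  obtain ⟨v, hv, hvA⟩ : ∃ v ∈ W \ S, v ∉ A := by
    by_contra! hall
    exact hAW (Finset.Subset.antisymm hA hall)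
  set B := (W \ S) \ A with hB
  have hAm : ∀ x ∈ A, x ∈ W ∧ x ∉ S := fun x hx => Finset.mem_sdiff.1 (hA hx)
  have hvB : v ∈ B := Finset.mem_sdiff.2 ⟨hv, hvA⟩
  have hBm : ∀ x, x ∈ B ↔ (x ∈ W ∧ x ∉ S) ∧ x ∉ A := fun x => by simp [hB]
  have hnoAB : ∀ a ∈ A, ∀ b ∈ B, ¬ G.Adj a b := fun a ha b hb hab =>
    ((hBm b).1 hb).2 (hcl a ha b (Finset.mem_sdiff.2 ((hBm b).1 hb).1) hab)
  have h1W : A ∪ S ⊂ W := by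
    refine ⟨by grind, fun hsub => ?_⟩
    have := hsub (Finset.mem_sdiff.1 hv).1
    grind
  have h2W : B ∪ S ⊂ W := by
    refine ⟨by grind, fun hsub => ?_⟩
    have := hsub (hAm u hu).1
    grind
  have h1c : 2 * s ≤ (A ∪ S).card := by
    refine (hdeg u (hAm u hu).1).le.trans (Finset.card_le_card fun x hx => ?_)
    have := hnoAB u hu x
    grind
  have h2c : 2 * s ≤ (B ∪ S).card := by
    refine (hdeg v (Finset.mem_sdiff.1 hv).1).le.trans (Finset.card_le_card fun x hx => ?_)
    have := fun hx => hnoAB x hx v hvB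
    have := @SimpleGraph.Adj.symm V G v x
    grind
  have hE1 := hmin _ h1W h1c
  have hE2 := hmin _ h2W h2c
  have hEle : ((W ×ˢ W).filter (fun x => G.Adj x.1 x.2)).card ≤
      (((A ∪ S) ×ˢ (A ∪ S)).filter (fun x => G.Adj x.1 x.2)).card +
        (((B ∪ S) ×ˢ (B ∪ S)).filter (fun x => G.Adj x.1 x.2)).card := by
    refine (Finset.card_le_card ?_).trans (Finset.card_union_le _ _)
    rintro ⟨a, b⟩ hab
    simp only [Finset.mem_filter, Finset.mem_product, Finset.mem_union] at hab ⊢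
    have h1 := hnoAB a
    have h2 := fun hb ha => hnoAB b hb a ha
    have h3 := hab.2.symm
    have h4 := hBm a
    have h5 := hBm b
    grind
  have hc1 := Finset.card_union_of_disjoint (s := A) (t := S)
    (Finset.disjoint_left.2 fun x hx => (hAm x hx).2)
  have hc2 := Finset.card_union_of_disjoint (s := B) (t := S)
    (Finset.disjoint_left.2 fun x hx => ((hBm x).1 hx).1.2)
  have hc3 := Finset.card_sdiff_add_card_eq_card hA
  rw [← hB] at hc3
  have hcs : (A ∪ S).card + (B ∪ S).card ≤ W.card + s := by omega
  nlinarith [Nat.mul_le_mul_left (4 * s) hcs]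

end Mader

section Constants

lemma ncard_edgeSet_le_of_not_hasKConnSubgraph {k n : ℕ} (hk : 2 ≤ k) (G : SimpleGraph (Fin n))
    (hG : ¬ HasKConnSubgraph k G) : G.edgeSet.ncard ≤ 2 * (k - 1) * n := by
  classical
  obtain ⟨s, rfl⟩ : ∃ s, k = s + 1 := ⟨k - 1, by omega⟩
  have hsum : ((Finset.univ ×ˢ Finset.univ : Finset (Fin n × Fin n)).filter
      (fun x => G.Adj x.1 x.2)).card = 2 * G.edgeSet.ncard := by
    rw [Set.ncard_eq_toFinset_card', ← SimpleGraph.edgeFinset, ← G.sum_degrees_eq_twice_card_edges,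
      Finset.card_filter, Finset.sum_product]
    refine Finset.sum_congr rfl fun v _ => ?_
    rw [← Finset.card_filter, ← SimpleGraph.card_neighborFinset_eq_degree,
      SimpleGraph.neighborFinset_eq_filter]
  rw [Nat.add_sub_cancel]
  by_cases hn : 2 * s ≤ n
  · by_contra! hlt
    obtain ⟨U, -, hU⟩ := exists_isKConn_of_card_adj G (s := s) (by omega) Finset.univ
      (by simpa using hn) (by rw [hsum, Finset.card_univ, Fintype.card_fin]; nlinarith)
    exact hG (hasKConnSubgraph_of_isKConn hU)
  · have := card_filter_adj_add_card_le G Finset.univ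
    rw [hsum, Finset.card_univ, Fintype.card_fin] at this
    nlinarith

lemma bddAbove_ncard_edgeSet {k : ℕ} (hk : 2 ≤ k) (n : ℕ) :
    BddAbove {m : ℕ | ∃ G : SimpleGraph (Fin n), ¬ HasKConnSubgraph k G ∧
      G.edgeSet.ncard = m} := by
  refine ⟨2 * (k - 1) * n, ?_⟩
  rintro m ⟨G, hG, rfl⟩
  exact ncard_edgeSet_le_of_not_hasKConnSubgraph hk G hG

lemma ncard_edgeSet_le_maxEdgesNoKConn {k n : ℕ} (hk : 2 ≤ k) (G : SimpleGraph (Fin n))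
    (hG : ¬ HasKConnSubgraph k G) : G.edgeSet.ncard ≤ maxEdgesNoKConn k n :=
  le_csSup (bddAbove_ncard_edgeSet hk n) ⟨G, hG, rfl⟩

lemma maxEdgesNoKConn_le {k : ℕ} (hk : 2 ≤ k) (n : ℕ) :
    maxEdgesNoKConn k n ≤ 2 * (k - 1) * n := by
  refine csSup_le' ?_
  rintro m ⟨G, hG, rfl⟩
  exact ncard_edgeSet_le_of_not_hasKConnSubgraph hk G hG

lemma density_le {k n : ℕ} (hk : 2 ≤ k) (hn : k < n) :
    (2 * (maxEdgesNoKConn k n : ℝ) + 2) / (n : ℝ) ≤ 6 * ((k : ℝ) - 1) := by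
  have hn0 : (0 : ℝ) < n := by exact_mod_cast (by omega : 0 < n)
  have hn1 : (1 : ℝ) ≤ n := by exact_mod_cast (by omega : 1 ≤ n)
  have hk2 : (2 : ℝ) ≤ k := by exact_mod_cast hk
  have h : (maxEdgesNoKConn k n : ℝ) ≤ 2 * ((k : ℝ) - 1) * n := by
    have := maxEdgesNoKConn_le hk n
    have h' : (maxEdgesNoKConn k n : ℝ) ≤ ((2 * (k - 1) * n : ℕ) : ℝ) := by exact_mod_cast this
    rwa [Nat.cast_mul, Nat.cast_mul, Nat.cast_sub (by omega), Nat.cast_ofNat, Nat.cast_one] at h'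
  rw [div_le_iff₀ hn0]
  nlinarith

lemma density_le_dConst {k n : ℕ} (hk : 2 ≤ k) (hn : k < n) :
    (2 * (maxEdgesNoKConn k n : ℝ) + 2) / (n : ℝ) ≤ dConst k := by
  refine le_csSup ⟨6 * ((k : ℝ) - 1), ?_⟩ ⟨n, hn, rfl⟩
  rintro x ⟨m, hm, rfl⟩
  exact density_le hk hm

lemma dConst_le {k : ℕ} (hk : 2 ≤ k) : dConst k ≤ 6 * ((k : ℝ) - 1) := by
  refine csSup_le ⟨_, k + 1, by omega, rfl⟩ ?_
  rintro x ⟨m, hm, rfl⟩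
  exact density_le hk hm

lemma dConst_le_gammaConst_mul {k : ℕ} (hk : 2 ≤ k) :
    dConst k ≤ gammaConst * ((k : ℝ) - 1) := by
  have hpos : ∀ l : ℕ, 2 ≤ l → (0 : ℝ) < (l : ℝ) - 1 := fun l hl => by
    have : (2 : ℝ) ≤ l := by exact_mod_cast hl
    linarith
  rw [← div_le_iff₀ (hpos k hk)]
  refine le_csSup ⟨6, ?_⟩ ⟨k, hk, rfl⟩
  rintro x ⟨l, hl, rfl⟩
  rw [div_le_iff₀ (hpos l hl)]
  exact dConst_le hl

lemma one_lt_gammaConst : 1 < gammaConst := by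
  classical
  set G : SimpleGraph (Fin 3) := SimpleGraph.edge 0 1
  have hG : ¬ HasKConnSubgraph 2 G := by
    intro h
    obtain ⟨W, -, hW⟩ := h.exists_isKConn (G := G) (Function.Embedding.refl _) (fun _ _ h => h)
    have hWc := hW.lt_card (by norm_num)
    have hWu : W = Finset.univ := Finset.eq_univ_of_card _
      (le_antisymm (Finset.card_le_univ _) (by rw [Fintype.card_fin]; exact hWc))
    subst hWu
    have := (hW ∅ (by simp) (by simp)).2 {2} (by simp) (by simp) (by
      simp only [G, SimpleGraph.edge_adj]
      decide)
    revert this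
    decide
  have h1 : 1 ≤ maxEdgesNoKConn 2 3 := by
    refine le_trans ?_ (ncard_edgeSet_le_maxEdgesNoKConn le_rfl G hG)
    rw [SimpleGraph.edgeSet_edge_of_ne (by decide), Set.ncard_singleton]
  have h2 := (density_le_dConst (k := 2) (n := 3) le_rfl (by norm_num)).trans
    (dConst_le_gammaConst_mul le_rfl)
  have h3 : (1 : ℝ) ≤ maxEdgesNoKConn 2 3 := by exact_mod_cast h1
  push_cast at h2
  linarith

end Constants

section Greedy

variable {V : Type*} [DecidableEq V] (G : SimpleGraph V) [DecidableRel G.Adj]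

lemma exists_isKConn_of_dConst_le {k : ℕ} (hk : 2 ≤ k) (R : Finset V) (hR : k < R.card)
    (hdeg : ∀ v ∈ R, dConst k ≤ ((R.filter (G.Adj v)).card : ℝ)) :
    ∃ W ⊆ R, IsKConn G k W := by
  classical
  set f : Fin R.card ↪ V := R.equivFin.symm.toEmbedding.trans (Function.Embedding.subtype _)
    with hf
  have hfR : Finset.univ.map f = R := by
    ext v
    simp only [Finset.mem_map, Finset.mem_univ, true_and]
    constructor
    · rintro ⟨i, rfl⟩
      exact (R.equivFin.symm i).2
    · intro hv
      exact ⟨R.equivFin ⟨v, hv⟩, by simp [hf]⟩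
  have hsub : HasKConnSubgraph k (G.comap f) := by
    by_contra hno
    have h1 := ncard_edgeSet_le_maxEdgesNoKConn hk _ hno
    have h2 := density_le_dConst hk hR
    have hR0 : (0 : ℝ) < R.card := by exact_mod_cast (by omega : 0 < R.card)
    have hd : ∀ i, (G.comap f).degree i = (R.filter (G.Adj (f i))).card := by
      intro i
      rw [← SimpleGraph.card_neighborFinset_eq_degree, SimpleGraph.neighborFinset_eq_filter,
        ← Finset.card_map f, ← congrArg (fun T => (T.filter (G.Adj (f i))).card) hfR,
        Finset.filter_map]
      rfl
    have h3 : ∑ i, ((G.comap f).degree i : ℝ) = 2 * ((G.comap f).edgeSet.ncard : ℝ) := by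
      rw [Set.ncard_eq_toFinset_card', ← SimpleGraph.edgeFinset]
      exact_mod_cast (G.comap f).sum_degrees_eq_twice_card_edges
    have h4 : R.card * dConst k ≤ ∑ i, ((G.comap f).degree i : ℝ) := by
      have : ∑ _i : Fin R.card, dConst k ≤ ∑ i, ((G.comap f).degree i : ℝ) := by
        refine Finset.sum_le_sum fun i _ => ?_
        rw [hd]
        exact hdeg _ (hfR.subset (Finset.mem_map_of_mem f (Finset.mem_univ i)))
      simpa using this
    rw [div_le_iff₀ hR0] at h2
    have h5 : ((G.comap f).edgeSet.ncard : ℝ) ≤ maxEdgesNoKConn k R.card := by exact_mod_cast h1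
    nlinarith
  have := hsub.exists_isKConn (G := G) f (fun _ _ h => h)
  rwa [hfR] at this

/-- A nonempty set whose induced minimum degree `d` is large contains a `k`-connected piece with
more than `d / γ` vertices. -/
lemma exists_large_isKConn {k : ℕ} (hk : 2 ≤ k) (R : Finset V) {d : ℝ}
    (hd : 2 * ((k : ℝ) - 1) * gammaConst < d) (hR : d + 1 ≤ R.card)
    (hdeg : ∀ v ∈ R, d ≤ ((R.filter (G.Adj v)).card : ℝ)) :
    ∃ W ⊆ R, IsKConn G k W ∧ d / gammaConst < W.card := by
  have hγ := one_lt_gammaConst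
  have hγ0 : 0 < gammaConst := by linarith
  have hk2 : (2 : ℝ) ≤ k := by exact_mod_cast hk
  have hd0 : 0 < d := lt_of_le_of_lt (by nlinarith) hd
  set K := ⌊d / gammaConst⌋₊ + 1 with hK
  have hKle : (K : ℝ) ≤ d / gammaConst + 1 := by
    rw [hK, Nat.cast_add, Nat.cast_one]
    linarith [Nat.floor_le (div_pos hd0 hγ0).le]
  have hltK : d / gammaConst < K := by
    rw [hK, Nat.cast_add, Nat.cast_one]
    exact Nat.lt_floor_add_one _
  have hkK : k ≤ K := by
    have h1 : 2 * ((k : ℝ) - 1) < d / gammaConst := by rwa [lt_div_iff₀ hγ0]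
    have : (k : ℝ) < K := by linarith
    exact_mod_cast this.le
  have hKR : K < R.card := by
    have : d / gammaConst < d := div_lt_self hd0 hγ
    have : (K : ℝ) < R.card := by linarith
    exact_mod_cast this
  obtain ⟨W, hWR, hW⟩ := exists_isKConn_of_dConst_le G (hk.trans hkK) R hKR (fun v hv => by
    refine le_trans ?_ (hdeg v hv)
    refine (dConst_le_gammaConst_mul (hk.trans hkK)).trans ?_
    calc gammaConst * ((K : ℝ) - 1) ≤ gammaConst * (d / gammaConst) :=
          mul_le_mul_of_nonneg_left (by linarith) hγ0.le
      _ = d := by field_simp)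
  refine ⟨W, hWR, hW.mono hkK, hltK.trans ?_⟩
  exact_mod_cast hW.lt_card (by omega)

variable [Fintype V]

lemma degree_le_of_few_neighbors {k : ℕ} (𝓐 : Finset (Finset V)) (v : V)
    (h : ∀ A ∈ 𝓐, (A.filter (G.Adj v)).card ≤ k) :
    G.degree v ≤ ((Finset.univ \ 𝓐.sup id).filter (G.Adj v)).card + 𝓐.card * k := by
  rw [← SimpleGraph.card_neighborFinset_eq_degree, SimpleGraph.neighborFinset_eq_filter]
  have hsub : Finset.univ.filter (G.Adj v) ⊆ (Finset.univ \ 𝓐.sup id).filter (G.Adj v) ∪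
      𝓐.biUnion (fun A => A.filter (G.Adj v)) := by
    intro x hx
    simp only [Finset.mem_union, Finset.mem_filter, Finset.mem_sdiff, Finset.mem_univ, true_and,
      Finset.mem_sup, Finset.mem_biUnion, id] at hx ⊢
    grind
  refine (Finset.card_le_card hsub).trans ((Finset.card_union_le _ _).trans ?_)
  exact Nat.add_le_add_left (Finset.card_biUnion_le_card_mul _ _ _ h) _

/-- A disjoint family of `i` `k`-connected pieces leaving at most `(D - (k-1)i)² / (2(k-1)γ)`
vertices uncovered can be extended greedily to a cover. -/
theorem exists_cover_of_partial_family {k : ℕ} (hk : 2 ≤ k) {D : ℝ}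
    (hD : ∀ v, D ≤ G.degree v) (𝓐 : Finset (Finset V)) (i : ℕ) (hi : 𝓐.card ≤ i)
    (hdisj : (𝓐 : Set (Finset V)).PairwiseDisjoint id) (hconn : ∀ A ∈ 𝓐, IsKConn G k A)
    (hDi : 0 ≤ D - ((k : ℝ) - 1) * i)
    (hcard : ((Finset.univ \ 𝓐.sup id).card : ℝ) * (2 * ((k : ℝ) - 1) * gammaConst) ≤
      (D - ((k : ℝ) - 1) * i) ^ 2) :
    ∃ 𝓑 : Finset (Finset V), (𝓑 : Set (Finset V)).PairwiseDisjoint id ∧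
      (∀ A ∈ 𝓑, IsKConn G k A) ∧ 𝓑.sup id = Finset.univ ∧ ((k : ℝ) - 1) * 𝓑.card ≤ D := by
  induction hr : (Finset.univ \ 𝓐.sup id).card using Nat.strong_induction_on
    generalizing 𝓐 i with
  | _ r ih =>
  subst hr
  have hγ := one_lt_gammaConst
  have hk2 : (2 : ℝ) ≤ k := by exact_mod_cast hk
  have hir : (𝓐.card : ℝ) ≤ i := by exact_mod_cast hi
  set R := Finset.univ \ 𝓐.sup id with hR
  have hmemR : ∀ x, x ∈ R ↔ ∀ A ∈ 𝓐, x ∉ A := fun x => by simp [hR, Finset.mem_sup]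
  rcases R.eq_empty_or_nonempty with hemp | hne
  · refine ⟨𝓐, hdisj, hconn, ?_, by nlinarith⟩
    exact Finset.univ_subset_iff.1 (Finset.sdiff_eq_empty_iff_subset.1 hemp)
  by_cases habs : ∃ v ∈ R, ∃ A ∈ 𝓐, k ≤ (A.filter (G.Adj v)).card
  · obtain ⟨v, hv, A, hA, hvA⟩ := habs
    have hvn := (hmemR v).1 hv
    have hmem' : ∀ x, x ∈ Finset.univ \ (insert (insert v A) (𝓐.erase A)).sup id ↔
        x ∈ R ∧ x ≠ v := by
      intro x
      simp only [hmemR, Finset.mem_sdiff, Finset.mem_univ, true_and, Finset.mem_sup,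
        Finset.mem_insert, Finset.mem_erase, id]
      grind
    have hlt : (Finset.univ \ (insert (insert v A) (𝓐.erase A)).sup id).card < R.card := by
      refine Finset.card_lt_card ⟨fun x hx => ((hmem' x).1 hx).1, fun hsub => ?_⟩
      exact ((hmem' v).1 (hsub hv)).2 rfl
    refine ih _ hlt (insert (insert v A) (𝓐.erase A)) i ?_ ?_ ?_ hDi ?_ rfl
    · have := Finset.card_insert_le (insert v A) (𝓐.erase A)
      have := Finset.card_erase_add_one hA
      omega
    · rw [Finset.coe_insert]
      refine Set.PairwiseDisjoint.insert
        (hdisj.subset (Finset.coe_subset.2 (Finset.erase_subset _ _))) fun B hB _ => ?_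
      obtain ⟨hBA, hB⟩ := Finset.mem_erase.1 hB
      exact Finset.disjoint_insert_left.2 ⟨hvn B hB, hdisj hA hB hBA.symm⟩
    · intro B hB
      rcases Finset.mem_insert.1 hB with rfl | hB
      · exact (hconn A hA).insert_vertex (hvn A hA) hvA
      · exact hconn B (Finset.mem_of_mem_erase hB)
    · refine le_trans (mul_le_mul_of_nonneg_right ?_ (by nlinarith)) hcard
      exact_mod_cast hlt.le
  · push Not at habs
    set d := D - ((k : ℝ) - 1) * i with hd
    have hdeg : ∀ v ∈ R, d ≤ ((R.filter (G.Adj v)).card : ℝ) := by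
      intro v hv
      have h1 := degree_le_of_few_neighbors G (k := k - 1) 𝓐 v
        (fun A hA => Nat.le_sub_one_of_lt (habs v hv A hA))
      have h2 : (G.degree v : ℝ) ≤ ((R.filter (G.Adj v)).card : ℝ) + 𝓐.card * ((k : ℝ) - 1) := by
        have h3 : (G.degree v : ℝ) ≤
          ((((Finset.univ \ 𝓐.sup id).filter (G.Adj v)).card + 𝓐.card * (k - 1) : ℕ) : ℝ) := by
            exact_mod_cast h1
        rwa [Nat.cast_add, Nat.cast_mul, Nat.cast_sub (by omega), Nat.cast_one] at h3
      have h4 := hD v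
      nlinarith
    have hdR : d + 1 ≤ R.card := by
      obtain ⟨v, hv⟩ := hne
      have h1 : (R.filter (G.Adj v)).card < R.card := by
        refine Finset.card_lt_card ⟨Finset.filter_subset _ _, fun hsub => ?_⟩
        exact G.loopless.irrefl v (Finset.mem_filter.1 (hsub hv)).2
      have h2 : ((R.filter (G.Adj v)).card : ℝ) + 1 ≤ R.card := by exact_mod_cast h1
      linarith [hdeg v hv]
    have hkγ : 0 < 2 * ((k : ℝ) - 1) * gammaConst := by nlinarith
    have hdbig : 2 * ((k : ℝ) - 1) * gammaConst < d := by
      by_contra! hle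
      nlinarith
    obtain ⟨W, hWR, hW, hWc⟩ := exists_large_isKConn G hk R hdbig hdR hdeg
    have hWdisj : ∀ B ∈ 𝓐, Disjoint W B := fun B hB =>
      Finset.disjoint_left.2 fun x hx => (hmemR x).1 (hWR hx) B hB
    have hR' : Finset.univ \ (insert W 𝓐).sup id = R \ W := by
      ext x
      simp only [hmemR, Finset.mem_sdiff, Finset.mem_univ, true_and, Finset.mem_sup,
        Finset.mem_insert, id]
      grind
    have hWpos : 0 < W.card := by have := hW.lt_card (by omega); omega
    have hcardW := Finset.card_sdiff_add_card_eq_card hWR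
    refine ih _ (by rw [hR']; omega) (insert W 𝓐) (i + 1)
      ((Finset.card_insert_le _ _).trans (by omega)) ?_ ?_ ?_ ?_ rfl
    · rw [Finset.coe_insert]
      exact hdisj.insert fun B hB _ => hWdisj B hB
    · intro B hB
      rcases Finset.mem_insert.1 hB with rfl | hB
      · exact hW
      · exact hconn B hB
    · push_cast
      nlinarith
    · rw [hR']
      have h1 : ((R \ W).card : ℝ) + W.card = R.card := by exact_mod_cast hcardW
      have h2 : d < W.card * gammaConst := by rwa [div_lt_iff₀ (by linarith)] at hWc
      have h3 : D - ((k : ℝ) - 1) * ((i + 1 : ℕ) : ℝ) = d - ((k : ℝ) - 1) := by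
        push_cast
        rw [hd]
        ring
      rw [h3, eq_sub_iff_add_eq.2 h1]
      nlinarith [mul_lt_mul_of_pos_left h2 (by linarith : (0 : ℝ) < 2 * ((k : ℝ) - 1))]

end Greedy

/-- **Theorem 11.** Let `k ≥ 2`, `c_k ≥ ((k-1)/k)·2γ` and `p = √(c_k n / k)`.
If `δ(G) ≥ k·p = √(c_k k n)`, then `G` has a `k`-proper partition into at most
`(k/(k-1))·p` parts. -/
theorem k_proper_partition_greedy {V : Type*} [Fintype V] [DecidableEq V]
    (k : ℕ) (hk : 2 ≤ k) (c : ℝ) (hc : c ≥ (((k : ℝ) - 1) / (k : ℝ)) * (2 * gammaConst))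
    (p : ℝ) (hp : p = Real.sqrt (c * (Fintype.card V : ℝ) / (k : ℝ)))
    (G : SimpleGraph V) [DecidableRel G.Adj]
    (hδ : (G.minDegree : ℝ) ≥ (k : ℝ) * p) :
    ∃ P : Finpartition (Finset.univ : Finset V), KProperPartition k G P ∧
      (P.parts.card : ℝ) ≤ ((k : ℝ) / ((k : ℝ) - 1)) * p := by
  have hγ := one_lt_gammaConst
  have hk2 : (2 : ℝ) ≤ k := by exact_mod_cast hk
  have hk0 : (0 : ℝ) < k := by linarith
  have hn0 : (0 : ℝ) ≤ Fintype.card V := Nat.cast_nonneg _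
  have hp0 : 0 ≤ p := hp ▸ Real.sqrt_nonneg _
  have hck : ((k : ℝ) - 1) * (2 * gammaConst) ≤ c * k := by
    have := mul_le_mul_of_nonneg_right hc hk0.le
    rwa [mul_right_comm, div_mul_cancel₀ _ hk0.ne'] at this
  have hc0 : 0 ≤ c := le_of_mul_le_mul_right (by nlinarith) hk0
  have hp2 : (k * p) ^ 2 = c * k * Fintype.card V := by
    rw [hp, mul_pow, Real.sq_sqrt (div_nonneg (mul_nonneg hc0 hn0) hk0.le)]
    field_simp
  obtain ⟨𝓑, hdisj, hconn, hsup, hcard⟩ := exists_cover_of_partial_family G hk (D := k * p)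
    (fun v => hδ.le.trans (by exact_mod_cast G.minDegree_le_degree v)) ∅ 0 (by simp) (by simp)
    (by simp) (by simpa using mul_nonneg hk0.le hp0) (by
      simp only [Finset.sup_empty, Finset.bot_eq_empty, Finset.sdiff_empty, Finset.card_univ,
        Nat.cast_zero, mul_zero, sub_zero, hp2]
      nlinarith)
  refine ⟨⟨𝓑, Finset.supIndep_iff_pairwiseDisjoint.2 hdisj, hsup, fun hbot => ?_⟩,
    fun A hA => (hconn A hA).kConnected_induce, ?_⟩
  · have := (hconn _ hbot).lt_card (by omega)
    simp at this
  · rw [div_mul_eq_mul_div, le_div_iff₀ (by linarith), mul_comm]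
    exact hcard
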